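/- Let n > 0, C_e > 0, ε ∈ (0,1), β ∈ ℝ, and α ∈ ℝ with α < −1. Define κ = β²/2 + β and, for ρ > 0, 𝒥(ρ) = e^{1/ρ}·ρ^α·[(κ+1)·Γ(α+1, 1/ρ) − ((κ − β/2)/ρ²)·Γ(α−1, 1/ρ)], where Γ(a,x) = ∫_x^∞ t^{a−1} e^{−t} dt. Then lim_{ρ→∞} −ln(ε + (1−ε)·𝒥(ρ))/(n·C_e) = −ln(ε)/(n·C_e). -/

import Mathlib

open MeasureTheory Set Real Filter

/-- The upper incomplete gamma function `Γ(a,x) = ∫_x^∞ t^{a−1} e^{−t} dt`. -/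
noncomputable def upperGamma (a x : ℝ) : ℝ :=
  ∫ t in Set.Ioi x, t ^ (a - 1) * Real.exp (-t)

theorem upperGamma_nonneg (a : ℝ) {x : ℝ} (hx : 0 ≤ x) : 0 ≤ upperGamma a x :=
  setIntegral_nonneg measurableSet_Ioi fun _ ht =>
    mul_nonneg (rpow_nonneg (hx.trans (le_of_lt ht)) _) (exp_pos _).le

theorem upperGamma_le_rpow_div_neg {a x : ℝ} (ha : a < 0) (hx : 0 < x) :
    upperGamma a x ≤ x ^ a / (-a) := by
  have h : ∫ t in Ioi x, t ^ (a - 1) = x ^ a / (-a) := by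
    rw [integral_Ioi_rpow_of_lt (by linarith) hx, sub_add_cancel, neg_div, div_neg]
  rw [← h]
  refine integral_mono_of_nonneg ?_ (integrableOn_Ioi_rpow_of_lt (by linarith) hx) ?_
  · filter_upwards [ae_restrict_mem measurableSet_Ioi] with t ht
    exact mul_nonneg (rpow_nonneg (hx.trans ht).le _) (exp_pos _).le
  · filter_upwards [ae_restrict_mem measurableSet_Ioi] with t ht
    have ht0 : 0 < t := hx.trans ht
    exact mul_le_of_le_one_right (rpow_nonneg ht0.le _)
      (exp_le_one_iff.mpr (neg_nonpos.mpr ht0.le))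

theorem tendsto_rpow_sub_one_mul_upperGamma_one_div {a : ℝ} (ha : a < 0) :
    Tendsto (fun ρ : ℝ => ρ ^ (a - 1) * upperGamma a (1 / ρ)) atTop (nhds 0) := by
  have hlim : Tendsto (fun ρ : ℝ => ρ⁻¹ / (-a)) atTop (nhds 0) := by
    simpa using tendsto_inv_atTop_zero.div_const (-a)
  refine squeeze_zero' ?_ ?_ hlim
  · filter_upwards [eventually_gt_atTop 0] with ρ hρ
    exact mul_nonneg (rpow_nonneg hρ.le _) (upperGamma_nonneg a (one_div_pos.mpr hρ).le)
  · filter_upwards [eventually_gt_atTop 0] with ρ hρ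
    calc ρ ^ (a - 1) * upperGamma a (1 / ρ)
        ≤ ρ ^ (a - 1) * ((1 / ρ) ^ a / (-a)) :=
          mul_le_mul_of_nonneg_left
            (upperGamma_le_rpow_div_neg ha (one_div_pos.mpr hρ)) (rpow_nonneg hρ.le _)
      _ = ρ⁻¹ / (-a) := by
          have hpos : ρ ^ a ≠ 0 := (rpow_pos_of_pos hρ a).ne'
          rw [one_div, inv_rpow hρ.le, rpow_sub_one hρ.ne']
          field_simp

/-- for `n > 0`, `C_e > 0`, `ε ∈ (0,1)`, `α < −1`, with `κ = β²/2 + β` and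
`𝒥(ρ) = e^{1/ρ} ρ^α [(κ+1)Γ(α+1,1/ρ) − ((κ−β/2)/ρ²)Γ(α−1,1/ρ)]`, the supportable delay
exponent `−ln(ε + (1−ε)𝒥(ρ))/(n C_e)` tends to `−ln(ε)/(n C_e)` as `ρ → ∞`. -/
theorem delay_exponent_high_SNR_limit
    (n Ce ε β α : ℝ) (hn : 0 < n) (hCe : 0 < Ce) (hε0 : 0 < ε) (hε1 : ε < 1)
    (hα : α < -1) (κ : ℝ) (hκ : κ = β ^ 2 / 2 + β)
    (J : ℝ → ℝ)
    (hJ : ∀ ρ : ℝ, 0 < ρ →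
      J ρ = Real.exp (1 / ρ) * ρ ^ α *
        ((κ + 1) * upperGamma (α + 1) (1 / ρ) -
          (κ - β / 2) / ρ ^ 2 * upperGamma (α - 1) (1 / ρ))) :
    Filter.Tendsto (fun ρ => -Real.log (ε + (1 - ε) * J ρ) / (n * Ce))
      Filter.atTop (nhds (-Real.log ε / (n * Ce))) := by
  have hJ0 : Tendsto J atTop (nhds 0) := by
    have hexp : Tendsto (fun ρ : ℝ => Real.exp (1 / ρ)) atTop (nhds 1) := by
      simpa [Function.comp_def] using (continuous_exp.tendsto 0).comp tendsto_inv_atTop_zero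
    have hlim := hexp.mul
      (((tendsto_rpow_sub_one_mul_upperGamma_one_div (a := α + 1) (by linarith)).const_mul
        (κ + 1)).sub
      ((tendsto_rpow_sub_one_mul_upperGamma_one_div (a := α - 1) (by linarith)).const_mul
        (κ - β / 2)))
    simp only [mul_zero, sub_zero] at hlim
    refine hlim.congr' ?_
    filter_upwards [eventually_gt_atTop 0] with ρ hρ
    have hpow : ρ ^ (α - 1 - 1) = ρ ^ α / ρ ^ 2 := by
      rw [rpow_sub_one hρ.ne', rpow_sub_one hρ.ne', div_div, sq]
    rw [hJ ρ hρ, add_sub_cancel_right, hpow]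
    ring
  have harg : Tendsto (fun ρ => ε + (1 - ε) * J ρ) atTop (nhds ε) := by
    simpa using (hJ0.const_mul (1 - ε)).const_add ε
  exact (harg.log hε0.ne').neg.div_const (n * Ce)
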